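/- arXiv:1411.4819 — 2 statements merged into one kernel-verified Lean document; each statement's English description precedes it below -/
import Mathlib

section
/- Every 2-connected graph with n vertices and minimum degree δ contains at least (δ−2)²·n²/8 + 3(δ−2)·n/4 + 1 distinct cycles. -/
open SimpleGraph

variable {V : Type*}

/-- A graph is `k`-connected if it has more than `k` vertices and no set of fewer than `k`
vertices whose deletion leaves a disconnected graph. -/
def IsKConnected [Fintype V] (k : ℕ) (G : SimpleGraph V) : Prop :=
  k < Fintype.card V ∧
    ∀ S : Finset V, S.card < k → (G.induce ((↑S : Set V)ᶜ)).Connected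

/-- `H` is a subgraph of `G` that is a cycle. -/
def IsCycleSubgraph {G : SimpleGraph V} (H : G.Subgraph) : Prop :=
  ∃ (u : V) (c : G.Walk u u), c.IsCycle ∧ H = c.toSubgraph

open scoped symmDiff

namespace BinarySpace

variable {E : Type*} [DecidableEq E]

/-- `W` is a linear subspace of the binary space of subsets of `X`. -/
structure IsSpace (X : Finset E) (W : Finset (Finset E)) : Prop where
  subset : ∀ x ∈ W, x ⊆ X
  empty_mem : ∅ ∈ W
  symmDiff_mem : ∀ x ∈ W, ∀ y ∈ W, x ∆ y ∈ W

/-- The space `W` on the ground set `X` has no nontrivial direct sum decomposition along `X`. -/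
def IsConn (X : Finset E) (W : Finset (Finset E)) : Prop :=
  ∀ A ⊆ X, (∀ x ∈ W, x ∩ A ∈ W) → A = ∅ ∨ A = X

/-- The minimal nonempty members of `W`. -/
def circuits (W : Finset (Finset E)) : Finset (Finset E) :=
  {C ∈ W | C.Nonempty ∧ ∀ D ∈ W, D ⊆ C → D.Nonempty → D = C}

/-- The members of `W` avoiding `e`. -/
def del (W : Finset (Finset E)) (e : E) : Finset (Finset E) := {x ∈ W | e ∉ x}

/-- The members of `W` with the coordinate `e` forgotten. -/
def contr (W : Finset (Finset E)) (e : E) : Finset (Finset E) := W.image (·.erase e)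

variable {X : Finset E} {W : Finset (Finset E)} {e f : E}

lemma mem_circuits {C : Finset E} :
    C ∈ circuits W ↔ C ∈ W ∧ C.Nonempty ∧ ∀ D ∈ W, D ⊆ C → D.Nonempty → D = C := by
  simp [circuits]

lemma IsSpace.del (h : IsSpace X W) (e : E) : IsSpace (X.erase e) (del W e) where
  subset x hx := by
    simp only [BinarySpace.del, Finset.mem_filter] at hx
    exact Finset.subset_erase.2 ⟨h.subset x hx.1, hx.2⟩
  empty_mem := by simp [BinarySpace.del, h.empty_mem]
  symmDiff_mem x hx y hy := by
    simp only [BinarySpace.del, Finset.mem_filter] at hx hy ⊢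
    refine ⟨h.symmDiff_mem x hx.1 y hy.1, ?_⟩
    simp [Finset.mem_symmDiff, hx.2, hy.2]

lemma IsSpace.contr (h : IsSpace X W) (e : E) : IsSpace (X.erase e) (contr W e) where
  subset x hx := by
    obtain ⟨y, hy, rfl⟩ := Finset.mem_image.1 hx
    exact Finset.erase_subset_erase e (h.subset y hy)
  empty_mem := Finset.mem_image.2 ⟨∅, h.empty_mem, by simp⟩
  symmDiff_mem x hx y hy := by
    obtain ⟨x, hxW, rfl⟩ := Finset.mem_image.1 hx
    obtain ⟨y, hyW, rfl⟩ := Finset.mem_image.1 hy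
    refine Finset.mem_image.2 ⟨x ∆ y, h.symmDiff_mem x hxW y hyW, ?_⟩
    ext a
    simp only [Finset.mem_symmDiff, Finset.mem_erase]
    tauto

lemma IsSpace.mem_of_eq_symmDiff (h : IsSpace X W) {x y z : Finset E} (hx : x ∈ W) (hy : y ∈ W)
    (hz : ∀ a, a ∈ z ↔ (a ∈ x ∧ a ∉ y ∨ a ∈ y ∧ a ∉ x)) : z ∈ W := by
  have : z = x ∆ y := by ext a; rw [hz, Finset.mem_symmDiff]
  exact this ▸ h.symmDiff_mem x hx y hy

lemma mem_contr {z : Finset E} (he : e ∉ z) :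
    z ∈ contr W e ↔ z ∈ W ∨ insert e z ∈ W := by
  simp only [contr, Finset.mem_image]
  constructor
  · rintro ⟨x, hx, rfl⟩
    by_cases hex : e ∈ x
    · right; rwa [Finset.insert_erase hex]
    · left; rwa [Finset.erase_eq_of_notMem hex]
  · rintro (h | h)
    · exact ⟨z, h, Finset.erase_eq_of_notMem he⟩
    · exact ⟨_, h, Finset.erase_insert he⟩

/-- The uncrossing step: a separator `A, B` of the deletion and a separator `C, D` of the
contraction yield the separator `A ∩ C` or `B ∩ D` of `W`. -/
lemma IsSpace.uncross (h : IsSpace X W) {A B C D : Finset E}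
    (hAB : Disjoint A B) (hABX : A ∪ B = X.erase e)
    (hCD : Disjoint C D) (hCDX : C ∪ D = X.erase e)
    (hA : ∀ x ∈ W, e ∉ x → x ∩ A ∈ W)
    (hC : ∀ x ∈ W, x ∩ C ∈ W ∨ insert e (x ∩ C) ∈ W) :
    (∀ x ∈ W, x ∩ (A ∩ C) ∈ W) ∨ (∀ x ∈ W, x ∩ (B ∩ D) ∈ W) := by
  have heA : e ∉ A := fun ha =>
    Finset.notMem_erase e X (hABX.le (Finset.mem_union_left B ha))
  have heC : e ∉ C := fun ha =>
    Finset.notMem_erase e X (hCDX.le (Finset.mem_union_left D ha))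
  by_contra! hcon
  obtain ⟨⟨x, hx, hxn⟩, y, hy, hyn⟩ := hcon
  have hyX := h.subset y hy
  have hyB : ∀ a ∈ y, (a ∈ B ↔ a ≠ e ∧ a ∉ A) := fun a ha => by
    have h1 := Finset.ext_iff.1 hABX a
    have h3 : a ∈ A → a ∉ B := fun h' => Finset.disjoint_left.1 hAB h'
    simp only [Finset.mem_union, Finset.mem_erase, hyX ha, and_true] at h1
    tauto
  have hyD : ∀ a ∈ y, (a ∈ D ↔ a ≠ e ∧ a ∉ C) := fun a ha => by
    have h1 := Finset.ext_iff.1 hCDX a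
    have h3 : a ∈ C → a ∉ D := fun h' => Finset.disjoint_left.1 hCD h'
    simp only [Finset.mem_union, Finset.mem_erase, hyX ha, and_true] at h1
    tauto
  clear hAB hABX hCD hCDX hyX
  have key1 : insert e (x ∩ (A ∩ C)) ∈ W ∨ (e ∈ x ∧ insert e (x ∩ C) ∈ W) := by
    by_cases hex : e ∈ x
    · right
      refine ⟨hex, (hC x hx).resolve_left fun h1 => hxn ?_⟩
      have := hA _ h1 (by clear h hA hC; grind)
      convert this using 1; clear h hA hC; grind
    · left
      have h1 := hA x hx hex
      have h2 := hC _ h1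
      rw [Finset.inter_assoc] at h2
      exact h2.resolve_left hxn
  have key2 : insert e (y ∩ (B ∩ D)) ∈ W ∨ (e ∈ y ∧ insert e (y ∩ D) ∈ W) := by
    by_cases hey : e ∈ y
    · right
      refine ⟨hey, ?_⟩
      rcases hC y hy with h1 | h1
      · exact h.mem_of_eq_symmDiff hy h1 (by clear h hA hC; grind)
      · exfalso
        have h2 := h.symmDiff_mem y hy _ h1
        have h3 := hA _ h2 (by clear h hA hC; grind [Finset.mem_symmDiff])
        exact hyn (h.mem_of_eq_symmDiff h2 h3 (by clear h hA hC; grind [Finset.mem_symmDiff]))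
    · left
      have h1 : y ∩ B ∈ W := h.mem_of_eq_symmDiff hy (hA y hy hey) (by clear h hA hC; grind)
      rcases hC _ h1 with h2 | h2
      · exact absurd (h.mem_of_eq_symmDiff h1 h2 (by clear h hA hC; grind)) hyn
      · exact h.mem_of_eq_symmDiff h1 h2 (by clear h hA hC; grind)
  rcases key2 with h2 | ⟨-, h2⟩
  · rcases key1 with h1 | ⟨-, h1⟩
    · have h3 := h.symmDiff_mem _ h1 _ h2
      have h4 := hA _ h3 (by clear h hA hC; grind [Finset.mem_symmDiff])
      apply hxn
      convert h4 using 1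
      clear h hA hC
      grind [Finset.mem_symmDiff]
    · have h3 := h.symmDiff_mem _ h1 _ h2
      have h4 := hA _ h3 (by clear h hA hC; grind [Finset.mem_symmDiff])
      apply hxn
      convert h4 using 1
      clear h hA hC
      grind [Finset.mem_symmDiff]
  · have main : insert e (x ∩ (A ∩ C)) ∈ W → False := fun h1 => by
      have h3 := h.symmDiff_mem _ h1 _ h2
      have h4 := hA _ h3 (by clear h hA hC; grind [Finset.mem_symmDiff])
      apply hyn
      refine h.mem_of_eq_symmDiff h3 h4 ?_
      clear h hA hC
      grind [Finset.mem_symmDiff]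
    rcases key1 with h1 | ⟨-, h1⟩
    · exact main h1
    · have h3 := h.symmDiff_mem _ h1 _ h2
      have h4 := hA _ h3 (by clear h hA hC; grind [Finset.mem_symmDiff])
      have h5 : ((insert e (x ∩ C)) ∆ (insert e (y ∩ D)) ∩ A) ∩ C = x ∩ (A ∩ C) := by
        clear h hA hC
        grind [Finset.mem_symmDiff]
      have h6 := hC _ h4
      rw [h5] at h6
      exact h6.elim hxn main

/-- If a binary space is connected then so is its deletion or its contraction at `e`. -/
lemma IsConn.del_or_contr (h : IsSpace X W) (hc : IsConn X W) (he : e ∈ X) :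
    IsConn (X.erase e) (del W e) ∨ IsConn (X.erase e) (contr W e) := by
  by_contra! hcon
  obtain ⟨h1, h2⟩ := hcon
  simp only [IsConn] at h1 h2
  push Not at h1 h2
  obtain ⟨A, hAX, hA, hA0, hA1⟩ := h1
  obtain ⟨C, hCX, hC, hC0, hC1⟩ := h2
  have hA' : ∀ x ∈ W, e ∉ x → x ∩ A ∈ W := fun x hx hex => by
    have := hA x (by simp [del, hx, hex])
    simp only [del, Finset.mem_filter] at this
    exact this.1
  have hB' : ∀ x ∈ W, e ∉ x → x ∩ (X.erase e \ A) ∈ W := fun x hx hex =>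
    h.mem_of_eq_symmDiff hx (hA' x hx hex) (by
      have := h.subset x hx
      clear hA hC hA'
      grind)
  have heA : e ∉ A := fun h' => by simpa using hAX h'
  have heC : e ∉ C := fun h' => by simpa using hCX h'
  have hC' : ∀ x ∈ W, x ∩ C ∈ W ∨ insert e (x ∩ C) ∈ W := fun x hx => by
    have := hC _ (Finset.mem_image_of_mem _ hx)
    rw [mem_contr (by simp)] at this
    have h3 : x.erase e ∩ C = x ∩ C := by clear hA hC hA' hB'; grind
    rwa [h3] at this
  have hsub : ∀ S, (∀ x ∈ W, x ∩ S ∈ W) → S ⊆ X.erase e → S = ∅ := fun S hS hSX =>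
    (hc S (hSX.trans (Finset.erase_subset _ _)) hS).resolve_right fun h' => by
      rw [h'] at hSX
      simpa using hSX he
  have hAd : A ∪ (X.erase e \ A) = X.erase e := Finset.union_sdiff_of_subset hAX
  have hCd : C ∪ (X.erase e \ C) = X.erase e := Finset.union_sdiff_of_subset hCX
  have u1 := h.uncross Finset.disjoint_sdiff hAd Finset.disjoint_sdiff hCd hA' hC'
  have u2 := h.uncross Finset.sdiff_disjoint ((Finset.union_comm _ _).trans hAd)
    Finset.disjoint_sdiff hCd hB' hC'
  obtain ⟨a, ha⟩ := hA0
  obtain ⟨c, hcc⟩ := hC0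
  obtain ⟨b, hb, hbA⟩ := Finset.exists_of_ssubset (hAX.ssubset_of_ne hA1)
  obtain ⟨d, hd, hdC⟩ := Finset.exists_of_ssubset (hCX.ssubset_of_ne hC1)
  have hl : ∀ P Q : Finset E, P ⊆ X.erase e → P ∩ Q ⊆ X.erase e := fun P Q hP =>
    Finset.inter_subset_left.trans hP
  have hs : X.erase e \ A ⊆ X.erase e := Finset.sdiff_subset
  have v1 := u1.imp (fun h' => hsub _ h' (hl _ _ hAX)) (fun h' => hsub _ h' (hl _ _ hs))
  have v2 := u2.imp (fun h' => hsub _ h' (hl _ _ hs)) (fun h' => hsub _ h' (hl _ _ hAX))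
  simp only [Finset.eq_empty_iff_forall_notMem, Finset.mem_inter, Finset.mem_sdiff] at v1 v2
  have haX := hAX ha
  have hcX := hCX hcc
  clear hA hC hA' hB' hC' hsub u1 u2
  rcases v1 with v1 | v1 <;> rcases v2 with v2 | v2
  · have := v1 c; have := v2 c; tauto
  · have := v1 a; have := v2 a; tauto
  · have := v1 b; have := v2 b; tauto
  · have := v1 d; have := v2 d; tauto

lemma mem_circuits_del {C : Finset E} : C ∈ circuits (del W e) ↔ C ∈ circuits W ∧ e ∉ C := by
  simp only [mem_circuits, del, Finset.mem_filter]
  constructor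
  · rintro ⟨⟨h1, h2⟩, h3, h4⟩
    exact ⟨⟨h1, h3, fun D hD hDC => h4 D ⟨hD, fun h => h2 (hDC h)⟩ hDC⟩, h2⟩
  · rintro ⟨⟨h1, h3, h4⟩, h2⟩
    exact ⟨⟨h1, h2⟩, h3, fun D hD => h4 D hD.1⟩

lemma exists_circuit_of_contr (he : {e} ∉ W) {C : Finset E} (hC : C ∈ circuits (contr W e)) :
    ∃ C' ∈ circuits W, C'.erase e = C := by
  rw [mem_circuits] at hC
  obtain ⟨h1, h2, h3⟩ := hC
  have heC : e ∉ C := by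
    obtain ⟨y, hy, rfl⟩ := Finset.mem_image.1 h1
    simp
  have key : ∀ D ∈ W, D ⊆ insert e C → D.Nonempty → D.erase e = C := fun D hD hDC hDn => by
    refine h3 _ (Finset.mem_image_of_mem _ hD) (by grind) ?_
    rw [Finset.nonempty_iff_ne_empty]
    intro h0
    rcases (Finset.erase_eq_empty_iff _ _).1 h0 with h | h
    · simp [h] at hDn
    · exact he (h ▸ hD)
  by_cases hCW : C ∈ W
  · refine ⟨C, mem_circuits.2 ⟨hCW, h2, fun D hD hDC hDn => ?_⟩, Finset.erase_eq_of_notMem heC⟩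
    rw [← key D hD (hDC.trans (Finset.subset_insert _ _)) hDn, Finset.erase_eq_of_notMem]
    exact fun h => heC (hDC h)
  · have hi := ((mem_contr heC).1 h1).resolve_left hCW
    refine ⟨_, mem_circuits.2 ⟨hi, by simp, fun D hD hDC hDn => ?_⟩, Finset.erase_insert heC⟩
    have hk := key D hD hDC hDn
    by_cases heD : e ∈ D
    · rw [← hk, Finset.insert_erase heD]
    · rw [Finset.erase_eq_of_notMem heD] at hk
      exact absurd (hk ▸ hD) hCW

lemma card_circuits_contr_le (he : {e} ∉ W) : (circuits (contr W e)).card ≤ (circuits W).card := by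
  refine (Finset.card_le_card ?_).trans (Finset.card_image_le (s := circuits W) (f := (·.erase e)))
  intro C hC
  exact Finset.mem_image.2 (exists_circuit_of_contr he hC)

lemma card_circuits_mem_contr_le (he : {e} ∉ W) :
    {C ∈ circuits (contr W e) | f ∈ C}.card ≤ {C ∈ circuits W | f ∈ C}.card := by
  refine (Finset.card_le_card ?_).trans
    (Finset.card_image_le (s := {C ∈ circuits W | f ∈ C}) (f := (·.erase e)))
  intro C hC
  rw [Finset.mem_filter] at hC
  obtain ⟨C', h1, rfl⟩ := exists_circuit_of_contr he hC.1
  exact Finset.mem_image.2 ⟨C', by simpa [h1] using Finset.mem_of_mem_erase hC.2, rfl⟩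

lemma card_contr (h : IsSpace X W) (he : {e} ∉ W) : (contr W e).card = W.card := by
  refine Finset.card_image_of_injOn fun x hx y hy hxy => ?_
  by_contra hne
  refine he (h.mem_of_eq_symmDiff hx hy fun a => ?_)
  have h1 : ∀ b, b ≠ e → (b ∈ x ↔ b ∈ y) := fun b hb => by
    have : b ∈ x.erase e ↔ b ∈ y.erase e := by rw [show x.erase e = y.erase e from hxy]
    simpa [hb] using this
  by_cases hae : a = e
  · subst hae
    have : ¬ (a ∈ x ↔ a ∈ y) := fun h2 => hne <| by
      ext b
      by_cases hb : b = a
      · rw [hb, h2]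
      · exact h1 b hb
    simp only [Finset.mem_singleton, true_iff]
    tauto
  · have := h1 a hae
    simp only [Finset.mem_singleton, hae, false_iff]
    tauto

lemma card_le_two_mul_card_del (h : IsSpace X W) (e : E) : W.card ≤ 2 * (del W e).card := by
  by_cases hx : ∃ x ∈ W, e ∈ x
  · obtain ⟨x, hx, hex⟩ := hx
    rw [← Finset.card_filter_add_card_filter_not (s := W) (fun x => e ∈ x), two_mul]
    refine Nat.add_le_add_right (Finset.card_le_card_of_injOn (x ∆ ·) ?_ ?_) _
    · intro y hy
      simp only [Finset.coe_filter, Set.mem_ofPred_eq, del] at hy ⊢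
      exact ⟨h.symmDiff_mem x hx y hy.1, by simp [Finset.mem_symmDiff, hex, hy.2]⟩
    · exact fun y _ z _ hyz => symmDiff_right_injective x hyz
  · push Not at hx
    have : del W e = W := Finset.filter_true_of_mem hx
    rw [this]; omega

lemma two_pow_le_card_del (h : IsSpace X W) (e : E) {μ : ℕ} (hμ : 2 ^ (μ + 1) ≤ W.card) :
    2 ^ μ ≤ (del W e).card := by
  have := card_le_two_mul_card_del h e
  rw [pow_succ] at hμ
  omega

lemma IsConn.singleton_notMem (h : IsSpace X W) (hc : IsConn X W) (he : e ∈ X) (hX : X ≠ {e}) :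
    {e} ∉ W := fun hW => by
  rcases hc {e} (by simpa using he) fun x _ => by
    by_cases hex : e ∈ x
    · rwa [Finset.inter_singleton_of_mem hex]
    · rw [Finset.inter_singleton_of_notMem hex]; exact h.empty_mem with h1 | h1
  · simp at h1
  · exact hX h1.symm

lemma IsConn.exists_mem (h : IsSpace X W) (hc : IsConn X W) (he : e ∈ X) (hX : X ≠ {e}) :
    ∃ x ∈ W, e ∈ x := by
  by_contra! hcon
  rcases hc {e} (by simpa using he) fun x hx => by
    rw [Finset.inter_singleton_of_notMem (hcon x hx)]; exact h.empty_mem with h1 | h1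
  · simp at h1
  · exact hX h1.symm

/-- In a connected binary space any two elements lie on a common circuit. -/
theorem IsConn.exists_circuit (h : IsSpace X W) (hc : IsConn X W) (he : e ∈ X) (hf : f ∈ X)
    (hef : e ≠ f) : ∃ C ∈ circuits W, e ∈ C ∧ f ∈ C := by
  induction hn : X.card generalizing X W with
  | zero => simp_all
  | succ n ih =>
    by_cases hg : ∃ g ∈ X, g ≠ e ∧ g ≠ f
    · obtain ⟨g, hg, hge, hgf⟩ := hg
      have hgW : {g} ∉ W := hc.singleton_notMem h hg (by grind)
      have he' : e ∈ X.erase g := by simp [he, hge.symm]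
      have hf' : f ∈ X.erase g := by simp [hf, hgf.symm]
      have hn' : (X.erase g).card = n := by rw [Finset.card_erase_of_mem hg, hn]; rfl
      rcases hc.del_or_contr h hg with hd | hd
      · obtain ⟨C, hC, h1⟩ := ih (h.del g) hd he' hf' hn'
        exact ⟨C, (mem_circuits_del.1 hC).1, h1⟩
      · obtain ⟨C, hC, h1⟩ := ih (h.contr g) hd he' hf' hn'
        obtain ⟨C', hC', rfl⟩ := exists_circuit_of_contr hgW hC
        exact ⟨C', hC', Finset.mem_of_mem_erase h1.1, Finset.mem_of_mem_erase h1.2⟩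
    · push Not at hg
      have heW : {e} ∉ W := hc.singleton_notMem h he (by grind)
      have hfW : {f} ∉ W := hc.singleton_notMem h hf (by grind)
      obtain ⟨x, hx, hex⟩ := hc.exists_mem h he (by grind)
      have hsub := h.subset x hx
      have key : ∀ D ∈ W, D ⊆ X → D.Nonempty → D = {e, f} := fun D hD hDX hDn => by
        have hDef : D ⊆ {e, f} := fun g hgD => by
          have := hg g (hDX hgD)
          simp only [Finset.mem_insert, Finset.mem_singleton]
          tauto
        have hDe : D ≠ {e} := fun h' => heW (h' ▸ hD)
        have hDf : D ≠ {f} := fun h' => hfW (h' ▸ hD)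
        clear ih hg
        refine hDef.antisymm fun g hgef => ?_
        by_contra hgD
        obtain ⟨a, ha⟩ := hDn
        have h1 : D = {a} := Finset.eq_singleton_iff_unique_mem.2 ⟨ha, fun b hb => by grind⟩
        grind
      have hxe := key x hx hsub ⟨e, hex⟩
      refine ⟨x, mem_circuits.2 ⟨hx, ⟨e, hex⟩, fun D hD hDx hDn => ?_⟩, hex, by simp [hxe]⟩
      rw [hxe, key D hD (hDx.trans hsub) hDn]

lemma IsSpace.card_le_two (h : IsSpace {e} W) : W.card ≤ 2 := by
  have : W ⊆ ({e} : Finset E).powerset := fun x hx => Finset.mem_powerset.2 (h.subset x hx)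
  simpa using Finset.card_le_card this

/-- In a connected binary space of dimension `μ` every element lies on at least `μ` circuits. -/
theorem IsConn.le_card_circuits_mem (h : IsSpace X W) (hc : IsConn X W) (he : e ∈ X) {μ : ℕ}
    (hμ : 2 ^ μ ≤ W.card) : μ ≤ {C ∈ circuits W | e ∈ C}.card := by
  induction hn : X.card generalizing X W μ with
  | zero => simp_all
  | succ n ih =>
    obtain _ | μ := μ
    · simp
    by_cases hX : X = {e}
    · subst hX
      have h2 := h.card_le_two
      have hμ0 : μ = 0 := by
        have : 2 ^ (μ + 1) ≤ 2 ^ 1 := by omega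
        have := (Nat.pow_le_pow_iff_right (by norm_num : 1 < 2)).1 this
        omega
      subst hμ0
      obtain ⟨x, hx, hxn⟩ := Finset.exists_mem_ne (by omega : 1 < W.card) ∅
      have hxe : ∀ y ∈ W, y.Nonempty → y = {e} := fun y hy hyn =>
        (Finset.subset_singleton_iff.1 (h.subset y hy)).resolve_left hyn.ne_empty
      have hxn' := Finset.nonempty_iff_ne_empty.2 hxn
      refine Finset.card_pos.2 ⟨x, Finset.mem_filter.2 ⟨mem_circuits.2
        ⟨hx, hxn', fun D hD _ hDn => ?_⟩, ?_⟩⟩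
      · rw [hxe D hD hDn, hxe x hx hxn']
      · simp [hxe x hx hxn']
    · obtain ⟨f, hf, hfe⟩ : ∃ f ∈ X, f ≠ e := by
        by_contra! hcon
        exact hX (Finset.eq_singleton_iff_unique_mem.2 ⟨he, hcon⟩)
      have he' : e ∈ X.erase f := by simp [he, hfe.symm]
      have hn' : (X.erase f).card = n := by rw [Finset.card_erase_of_mem hf, hn]; rfl
      rcases hc.del_or_contr h hf with hd | hd
      · have h1 := ih (h.del f) hd he' (two_pow_le_card_del h f hμ) hn'
        obtain ⟨C, hC, heC, hfC⟩ := hc.exists_circuit h he hf hfe.symm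
        refine Nat.lt_of_le_of_lt h1 (Finset.card_lt_card ?_)
        refine Finset.ssubset_iff_subset_ne.2 ⟨fun D hD => ?_, fun heq => ?_⟩
        · simp only [Finset.mem_filter, mem_circuits_del] at hD ⊢
          exact ⟨hD.1.1, hD.2⟩
        · have : C ∈ ({C ∈ circuits W | e ∈ C} : Finset _) := by simp [hC, heC]
          rw [← heq, Finset.mem_filter, mem_circuits_del] at this
          exact this.1.2 hfC
      · have hfW : {f} ∉ W := hc.singleton_notMem h hf (by grind)
        have h1 := ih (h.contr f) hd he' (by rwa [card_contr h hfW]) hn'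
        exact h1.trans (card_circuits_mem_contr_le hfW)

/-- A connected binary space of dimension `μ` has at least `μ (μ + 1) / 2` circuits. -/
theorem IsConn.mul_succ_le_two_mul_card_circuits (h : IsSpace X W) (hc : IsConn X W) {μ : ℕ}
    (hμ : 2 ^ μ ≤ W.card) : μ * (μ + 1) ≤ 2 * (circuits W).card := by
  induction hn : X.card generalizing X W μ with
  | zero =>
    rw [Finset.card_eq_zero] at hn
    subst hn
    have h1 : W ⊆ {∅} := fun x hx => by simpa using h.subset x hx
    have h2 := Finset.card_le_card h1
    obtain _ | μ := μ
    · simp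
    · rw [pow_succ] at hμ
      have := Nat.one_le_two_pow (n := μ)
      simp at h2
      omega
  | succ n ih =>
    obtain _ | μ := μ
    · simp
    obtain ⟨e, he⟩ : X.Nonempty := Finset.card_pos.1 (by omega)
    have hn' : (X.erase e).card = n := by rw [Finset.card_erase_of_mem he, hn]; rfl
    have hdel : IsConn (X.erase e) (del W e) →
        (μ + 1) * (μ + 1 + 1) ≤ 2 * (circuits W).card := fun hd => by
      have h1 := ih (h.del e) hd (two_pow_le_card_del h e hμ) hn'
      have h2 := hc.le_card_circuits_mem h he hμ
      have h3 := Finset.card_filter_add_card_filter_not (s := circuits W) (fun C => e ∈ C)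
      have h4 : circuits (del W e) = {C ∈ circuits W | ¬ e ∈ C} := by
        ext C; simp [mem_circuits_del]
      rw [h4] at h1
      nlinarith
    by_cases hX : X = {e}
    · refine hdel fun A hA _ => Or.inl ?_
      simpa [hX] using hA
    · rcases hc.del_or_contr h he with hd | hd
      · exact hdel hd
      · have heW := hc.singleton_notMem h he hX
        exact (ih (h.contr e) hd (by rwa [card_contr h heW]) hn').trans
          (Nat.mul_le_mul_left 2 (card_circuits_contr_le heW))

end BinarySpace

namespace SimpleGraph

variable (G : SimpleGraph V)

open Classical in
/-- The number of edges of `S` at the vertex `v`. -/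
noncomputable def edgeDegree (S : Finset (Sym2 V)) (v : V) : ℕ := {e ∈ S | v ∈ e}.card

open Classical in
/-- The binary cycle space of a finite graph: sets of edges meeting each vertex evenly. -/
noncomputable def cycleSpace [Fintype V] : Finset (Finset (Sym2 V)) :=
  {S ∈ G.edgeFinset.powerset | ∀ v, Even (edgeDegree S v)}

open Classical in
lemma mem_cycleSpace [Fintype V] {S : Finset (Sym2 V)} :
    S ∈ G.cycleSpace ↔ (∀ e ∈ S, e ∈ G.edgeSet) ∧ ∀ v, Even (edgeDegree S v) := by
  simp [cycleSpace, Finset.subset_iff]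

open Classical in
lemma even_edgeDegree_symmDiff (S T : Finset (Sym2 V)) (v : V) :
    Even (edgeDegree (S ∆ T) v) ↔ (Even (edgeDegree S v) ↔ Even (edgeDegree T v)) := by
  have h1 : {e ∈ S ∆ T | v ∈ e} = {e ∈ S | v ∈ e} ∆ {e ∈ T | v ∈ e} := by
    ext e
    simp only [Finset.mem_filter, Finset.mem_symmDiff]
    tauto
  have h2 : ∀ A B : Finset (Sym2 V), (A ∆ B).card + 2 * (A ∩ B).card = A.card + B.card := by
    intro A B
    have hd : Disjoint (A \ B) (B \ A) := disjoint_sdiff_sdiff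
    have := Finset.card_sdiff_add_card_inter A B
    have := Finset.card_sdiff_add_card_inter B A
    rw [Finset.inter_comm] at this
    rw [symmDiff, Finset.sup_eq_union, Finset.card_union_of_disjoint hd]
    omega
  have h3 := h2 {e ∈ S | v ∈ e} {e ∈ T | v ∈ e}
  rw [← h1] at h3
  simp only [edgeDegree, Nat.even_iff]
  omega

open Classical in
lemma isSpace_cycleSpace [Fintype V] : BinarySpace.IsSpace G.edgeFinset G.cycleSpace where
  subset S hS e he := by simpa using ((mem_cycleSpace G).1 hS).1 e he
  empty_mem := by simp [mem_cycleSpace, edgeDegree]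
  symmDiff_mem S hS T hT := by
    rw [mem_cycleSpace] at *
    refine ⟨fun e he => ?_, fun v => ?_⟩
    · rcases Finset.mem_symmDiff.1 he with h | h
      · exact hS.1 e h.1
      · exact hT.1 e h.1
    · simp [even_edgeDegree_symmDiff, hS.2 v, hT.2 v]

open Classical in
lemma sum_edgeDegree [Fintype V] {S : Finset (Sym2 V)} (hS : ∀ e ∈ S, e ∈ G.edgeSet) :
    ∑ v, edgeDegree S v = 2 * S.card := by
  have := Finset.sum_card_bipartiteAbove_eq_sum_card_bipartiteBelow
    (s := (Finset.univ : Finset V)) (t := S) (fun v e => v ∈ e)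
  simp only [Finset.bipartiteAbove, Finset.bipartiteBelow] at this
  simp only [edgeDegree]
  rw [this, Finset.sum_congr rfl (g := fun _ => 2), Finset.sum_const, smul_eq_mul, mul_comm]
  intro e he
  rw [← Sym2.card_toFinset_of_not_isDiag e (G.not_isDiag_of_mem_edgeSet (hS e he))]
  congr 1
  ext v
  simp

open Classical in
lemma two_pow_card_edgeFinset_le [Fintype V] (r : V) :
    2 ^ G.edgeFinset.card ≤ G.cycleSpace.card * 2 ^ (Fintype.card V - 1) := by
  set p : Finset (Sym2 V) → Finset V := fun S => {v | v ≠ r ∧ ¬ Even (edgeDegree S v)} with hp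
  rw [← Finset.card_powerset]
  refine (Finset.card_le_mul_card_image (f := p) _ G.cycleSpace.card fun T hT => ?_).trans
    (Nat.mul_le_mul_left _ ?_)
  · obtain ⟨S₀, hS₀, rfl⟩ := Finset.mem_image.1 hT
    refine Finset.card_le_card_of_injOn (S₀ ∆ ·) (fun S hS => ?_)
      fun _ _ _ _ h => symmDiff_right_injective S₀ h
    rw [Finset.mem_coe, Finset.mem_filter] at hS
    rw [Finset.mem_powerset] at hS hS₀
    have hsub : ∀ e ∈ S₀ ∆ S, e ∈ G.edgeSet := fun e he => by
      rcases Finset.mem_symmDiff.1 he with h | h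
      · simpa using hS₀ h.1
      · simpa using hS.1 h.1
    have hne : ∀ v ≠ r, Even (edgeDegree (S₀ ∆ S) v) := fun v hv => by
      have := Finset.ext_iff.1 hS.2 v
      simp only [hp, Finset.mem_filter_univ, hv, ne_eq, not_false_eq_true, true_and] at this
      rw [even_edgeDegree_symmDiff]
      tauto
    refine (mem_cycleSpace G).2 ⟨hsub, fun v => ?_⟩
    change Even (edgeDegree (S₀ ∆ S) v)
    by_cases hv : v = r
    · subst hv
      have h1 := G.sum_edgeDegree hsub
      rw [← Finset.add_sum_erase _ _ (Finset.mem_univ v)] at h1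
      have h2 : Even (∑ w ∈ Finset.univ.erase v, edgeDegree (S₀ ∆ S) w) :=
        Finset.even_sum _ fun w hw => hne w (Finset.ne_of_mem_erase hw)
      rw [Nat.even_iff] at *
      omega
    · exact hne v hv
  · calc (Finset.image p G.edgeFinset.powerset).card
        ≤ ((Finset.univ : Finset V).erase r).powerset.card := by
          refine Finset.card_le_card fun T hT => ?_
          obtain ⟨S, -, rfl⟩ := Finset.mem_image.1 hT
          rw [Finset.mem_powerset]
          intro v hv
          simp only [hp, Finset.mem_filter_univ] at hv
          simp [hv.1]
      _ = 2 ^ (Fintype.card V - 1) := by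
          rw [Finset.card_powerset, Finset.card_erase_of_mem (Finset.mem_univ r), Finset.card_univ]

open Classical in
lemma edgeDegree_toFinset {u v : V} {p : G.Walk u v} (hp : p.IsTrail) (x : V) :
    edgeDegree p.edges.toFinset x = p.edges.countP fun e => x ∈ e := by
  have h : {e ∈ p.edges.toFinset | x ∈ e} = (p.edges.filter fun e => x ∈ e).toFinset := by
    ext e
    simp
  rw [edgeDegree, List.countP_eq_length_filter, h,
    List.toFinset_card_of_nodup (hp.edges_nodup.filter _)]

open Classical in
lemma edges_mem_cycleSpace [Fintype V] {u : V} {p : G.Walk u u} (hp : p.IsTrail) :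
    p.edges.toFinset ∈ G.cycleSpace := by
  refine (mem_cycleSpace G).2 ⟨fun e he => p.edges_subset_edgeSet (by simpa using he), fun v => ?_⟩
  rw [edgeDegree_toFinset G hp]
  have := hp.even_countP_edges_iff v
  simp only [ne_eq, not_true_eq_false, false_implies, iff_true] at this
  exact this

open Classical in
/-- A nonempty set of edges meeting each vertex evenly contains the edges of a cycle. -/
lemma exists_isCycle_of_mem_cycleSpace [Fintype V] {S : Finset (Sym2 V)} (hS : S ∈ G.cycleSpace)
    (hne : S.Nonempty) : ∃ (u : V) (c : G.Walk u u), c.IsCycle ∧ c.edges.toFinset ⊆ S := by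
  rw [mem_cycleSpace] at hS
  have hadj : ∀ a b, (fromEdgeSet (S : Set (Sym2 V))).Adj a b ↔ s(a, b) ∈ S := fun a b => by
    rw [fromEdgeSet_adj]
    exact ⟨fun h => h.1, fun h => ⟨h, (hS.1 _ h : G.Adj a b).ne⟩⟩
  have hle : fromEdgeSet (S : Set (Sym2 V)) ≤ G := fun a b h => hS.1 _ ((hadj a b).1 h)
  by_cases hac : (fromEdgeSet (S : Set (Sym2 V))).IsAcyclic
  · exfalso
    obtain ⟨e, he⟩ := hne
    induction e with | h a b =>
    have : Nonempty V := ⟨a⟩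
    obtain ⟨u, v, p, hp, hmax⟩ :=
      Walk.exists_isPath_forall_isPath_length_le_length (fromEdgeSet (S : Set (Sym2 V)))
    have hab := (hadj a b).2 he
    have hlen : 1 ≤ p.length := by
      simpa using hmax _ _ hab.toWalk (by simpa using hab.ne)
    have hnil : ¬ p.Nil := fun h => by
      rw [← Walk.length_eq_zero_iff] at h
      omega
    have hpen : s(v, p.penultimate) ∈ S := (hadj _ _).1 (p.adj_penultimate hnil).symm
    have huniq : ∀ w, s(v, w) ∈ S → w = p.penultimate := fun w hw => by
      have hvw := (hadj v w).2 hw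
      refine hac.eq_penultimate_of_adj_end hp hvw ?_
      by_contra hsup
      have := hmax _ _ _ (hp.concat hsup hvw)
      simp at this
    have h1 : edgeDegree S v = 1 := by
      rw [edgeDegree, Finset.card_eq_one]
      refine ⟨s(v, p.penultimate), Finset.eq_singleton_iff_unique_mem.2 ⟨by simp [hpen], ?_⟩⟩
      intro e he
      rw [Finset.mem_filter] at he
      obtain ⟨w, rfl⟩ := Sym2.mem_iff_exists.1 he.2
      rw [huniq w he.1]
    have := hS.2 v
    rw [h1] at this
    exact absurd this (by decide)
  · simp only [IsAcyclic] at hac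
    push Not at hac
    obtain ⟨u, c, hc⟩ := hac
    refine ⟨u, c.mapLe hle, hc.mapLe hle, fun e he => ?_⟩
    rw [List.mem_toFinset, Walk.edges_mapLe_eq_edges] at he
    have := c.edges_subset_edgeSet he
    simp only [edgeSet_fromEdgeSet] at this
    exact this.1

open Classical in
lemma card_circuits_cycleSpace_le [Fintype V] :
    (BinarySpace.circuits G.cycleSpace).card ≤ {H : G.Subgraph | IsCycleSubgraph H}.ncard := by
  have key : ∀ S ∈ BinarySpace.circuits G.cycleSpace,
      ∃ H : G.Subgraph, IsCycleSubgraph H ∧ H.edgeSet = S := fun S hS => by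
    rw [BinarySpace.mem_circuits] at hS
    obtain ⟨u, c, hc, hcS⟩ := G.exists_isCycle_of_mem_cycleSpace hS.1 hS.2.1
    refine ⟨c.toSubgraph, ⟨u, c, hc, rfl⟩, ?_⟩
    rw [← hS.2.2 _ (G.edges_mem_cycleSpace hc.isTrail) hcS]
    · ext e
      simp
    · rw [List.toFinset_nonempty_iff]
      intro h
      exact hc.not_nil (by rw [← Walk.length_eq_zero_iff, ← Walk.length_edges, h]; rfl)
  choose! f hf hfe using key
  rw [← Set.ncard_coe_finset]
  refine Set.ncard_le_ncard_of_injOn f (fun S hS => hf S hS) (fun S hS T hT h => ?_)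
    (Set.toFinite _)
  rw [← Finset.coe_inj, ← hfe S hS, ← hfe T hT, h]

end SimpleGraph

section TwoConnected

variable {G : SimpleGraph V}

lemma IsKConnected.connected [Fintype V] (hG : IsKConnected 2 G) : G.Connected := by
  have h := hG.2 ∅ (by simp)
  rw [Finset.coe_empty, Set.compl_empty] at h
  exact (induceUnivIso G).connected_iff.1 h

/-- In a 2-connected graph two vertices other than `v` are joined by a path avoiding `v`. -/
lemma IsKConnected.exists_isPath_avoiding [Fintype V] (hG : IsKConnected 2 G) {a b v : V}
    (ha : a ≠ v) (hb : b ≠ v) : ∃ p : G.Walk a b, p.IsPath ∧ v ∉ p.support := by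
  have h := hG.2 {v} (by simp)
  obtain ⟨q, hq⟩ := (h.preconnected ⟨a, by simpa using ha⟩ ⟨b, by simpa using hb⟩).exists_isPath
  refine ⟨q.map (Embedding.induce _).toHom, hq.map Subtype.val_injective, fun hv => ?_⟩
  obtain ⟨⟨w, hw⟩, -, hwv⟩ := List.mem_map.1 (Walk.support_map (Embedding.induce _).toHom q ▸ hv)
  exact hw (by simpa using hwv)

open Classical in
lemma IsKConnected.two_le_minDegree [Fintype V] (hG : IsKConnected 2 G) : 2 ≤ G.minDegree := by
  have hn := hG.1
  have : Nontrivial V := Fintype.one_lt_card_iff_nontrivial.1 (by omega)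
  refine G.le_minDegree_of_forall_le_degree 2 fun v => ?_
  obtain ⟨w, hw⟩ := hG.connected.preconnected.exists_adj_of_nontrivial v
  obtain ⟨x, hxv, hxw⟩ : ∃ x, x ≠ v ∧ x ≠ w := by
    by_contra! hcon
    have : (Finset.univ : Finset V) ⊆ {v, w} := fun x _ => by
      by_cases hx : x = v
      · simp [hx]
      · simp [hcon x hx]
    have := (Finset.card_le_card this).trans Finset.card_le_two
    rw [Finset.card_univ] at this
    omega
  obtain ⟨p, hp, hwp⟩ := hG.exists_isPath_avoiding hw.ne hxw
  have hnil : ¬ p.Nil := Walk.not_nil_of_ne hxv.symm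
  have hadj := p.adj_snd hnil
  rw [← card_neighborFinset_eq_degree]
  refine Finset.one_lt_card.2 ⟨w, by simpa using hw, p.snd, by simpa using hadj, ?_⟩
  rintro h
  exact hwp (h ▸ p.getVert_mem_support 1)

open Classical in
/-- The cycle space of a 2-connected graph is connected. -/
lemma IsKConnected.isConn_cycleSpace [Fintype V] (hG : IsKConnected 2 G) :
    BinarySpace.IsConn G.edgeFinset G.cycleSpace := by
  intro A hA hAW
  by_contra! hcon
  obtain ⟨⟨e, he⟩, hAX⟩ := hcon
  obtain ⟨f, hf, hfA⟩ := Finset.exists_of_ssubset (hA.ssubset_of_ne hAX)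
  obtain ⟨v, a, b, hva, hvb, haA, hbA⟩ :
      ∃ v a b, G.Adj v a ∧ G.Adj v b ∧ s(v, a) ∈ A ∧ s(v, b) ∉ A := by
    by_contra! hno
    have hprop : ∀ x y, G.Reachable x y → (∃ z, s(x, z) ∈ A) → ∃ z, s(y, z) ∈ A := by
      rintro x y ⟨p⟩
      induction p with
      | nil => exact id
      | @cons x y z h p ih =>
        rintro ⟨w, hw⟩
        have hxw : G.Adj x w := by simpa using hA hw
        exact ih ⟨x, Sym2.eq_swap ▸ hno x w y hxw h hw⟩
    induction e with | h x y =>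
    induction f with | h z w =>
    have hzw : G.Adj z w := by simpa using hf
    obtain ⟨t, ht⟩ := hprop x z (hG.connected.preconnected x z) ⟨y, he⟩
    exact hfA (hno z t w (by simpa using hA ht) hzw ht)
  obtain ⟨p, hp, hvp⟩ := hG.exists_isPath_avoiding hva.ne' hvb.ne'
  have hab : a ≠ b := fun h => hbA (h ▸ haA)
  have hmem : ∀ e ∈ p.edges, v ∉ e := fun e he hve => by
    obtain ⟨w, rfl⟩ := Sym2.mem_iff_exists.1 hve
    exact hvp (p.fst_mem_support_of_mem_edges he)
  set c : G.Walk v v := Walk.cons hva (p.concat hvb.symm) with hc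
  have hce : ∀ e, e ∈ c.edges ↔ e = s(v, a) ∨ e ∈ p.edges ∨ e = s(v, b) := fun e => by
    simp [hc, Walk.edges_concat, Sym2.eq_swap (a := b)]
  have hct : c.IsTrail := by
    rw [hc, Walk.isTrail_cons]
    refine ⟨(hp.concat hvp hvb.symm).isTrail, fun h => ?_⟩
    rw [Walk.edges_concat, List.concat_eq_append, List.mem_append, List.mem_singleton] at h
    rcases h with h | h
    · exact hmem _ h (Sym2.mem_mk_left _ _)
    · rw [Sym2.eq_swap (a := b), Sym2.congr_right] at h
      exact hab h
  have h1 := hAW _ (G.edges_mem_cycleSpace hct)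
  have h2 : edgeDegree (c.edges.toFinset ∩ A) v = 1 := by
    rw [edgeDegree, Finset.card_eq_one]
    refine ⟨s(v, a), Finset.eq_singleton_iff_unique_mem.2 ⟨by simp [hce, haA], fun e he => ?_⟩⟩
    simp only [Finset.mem_filter, Finset.mem_inter, List.mem_toFinset, hce] at he
    obtain ⟨⟨h | h | h, heA⟩, hve⟩ := he
    · exact h
    · exact absurd hve (hmem e h)
    · exact absurd (h ▸ heA) hbA
  have h3 := ((mem_cycleSpace G).1 h1).2 v
  rw [h2] at h3
  exact absurd h3 (by decide)

end TwoConnected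

/-- Every 2-connected graph with `n` vertices and minimum degree `δ`
contains at least `(δ-2)² n² / 8 + 3 (δ-2) n / 4 + 1` distinct cycles. -/
theorem stmt3 [Fintype V] {G : SimpleGraph V} [DecidableRel G.Adj]
    (hG : IsKConnected 2 G) :
    ((G.minDegree : ℝ) - 2) ^ 2 * (Fintype.card V : ℝ) ^ 2 / 8 +
        3 * ((G.minDegree : ℝ) - 2) * (Fintype.card V : ℝ) / 4 + 1 ≤
      ({H : G.Subgraph | IsCycleSubgraph H}.ncard : ℝ) := by
  classical
  have hδ : 2 ≤ G.minDegree := by convert! hG.two_le_minDegree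
  have hn := hG.1
  have hm : Fintype.card V * G.minDegree ≤ 2 * G.edgeFinset.card := by
    rw [← G.sum_degrees_eq_twice_card_edges, ← smul_eq_mul, ← Finset.card_univ]
    exact Finset.card_nsmul_le_sum _ _ _ fun v _ => G.minDegree_le_degree v
  have hnm : Fintype.card V ≤ G.edgeFinset.card := by nlinarith
  obtain ⟨k, hk⟩ := Nat.exists_eq_add_of_le hnm
  obtain ⟨r⟩ : Nonempty V := Fintype.card_pos_iff.1 (by omega)
  have hdim : 2 ^ (k + 1) ≤ G.cycleSpace.card := by
    have h := G.two_pow_card_edgeFinset_le r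
    have hm' : G.edgeFinset.card = (k + 1) + (Fintype.card V - 1) := by omega
    have h2 : 2 ^ (k + 1) * 2 ^ (Fintype.card V - 1) ≤
        G.cycleSpace.card * 2 ^ (Fintype.card V - 1) := by
      rw [← pow_add, ← hm']
      convert! h
    exact Nat.le_of_mul_le_mul_right h2 (by positivity)
  have h1 := hG.isConn_cycleSpace.mul_succ_le_two_mul_card_circuits G.isSpace_cycleSpace hdim
  have h2 := h1.trans (Nat.mul_le_mul_left 2 G.card_circuits_cycleSpace_le)
  have hk' : ((G.minDegree : ℝ) - 2) * Fintype.card V ≤ 2 * k := by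
    have : (Fintype.card V : ℝ) * G.minDegree ≤ 2 * (Fintype.card V + k) := by
      exact_mod_cast hk ▸ hm
    linarith
  have h0 : 0 ≤ ((G.minDegree : ℝ) - 2) * Fintype.card V :=
    mul_nonneg (by rw [sub_nonneg]; exact_mod_cast hδ) (by positivity)
  have h3 : ((k : ℝ) + 1) * (k + 1 + 1) ≤ 2 * {H : G.Subgraph | IsCycleSubgraph H}.ncard := by
    exact_mod_cast h2
  nlinarith
end

section
/- Let G be a 3-connected graph, let v be a vertex of G, and let C be a cycle in the graph G−v obtained from G by deleting v. Then G contains a subgraph that is a K4-subdivision, contains the cycle C as a subgraph, and has v as one of its real vertices. -/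
open SimpleGraph

variable {V : Type*}

/-- `H` is a `K₄`-subdivision of `G` with branch ("real") vertices `b 0, b 1, b 2, b 3`:
there are six paths of length at least one in `G`, one between each pair of branch
vertices, whose union is `H`, such that any two of these paths intersect exactly in
their common endpoints (in particular they are internally disjoint from each other and
from the branch vertices). -/
def IsK4SubdivisionOn {G : SimpleGraph V} (H : G.Subgraph) (b : Fin 4 → V) : Prop :=
  Function.Injective b ∧
  ∃ P : ∀ p : Fin 4 × Fin 4, p.1 < p.2 → G.Walk (b p.1) (b p.2),
    (∀ p h, (P p h).IsPath) ∧
    (∀ p h, 0 < (P p h).length) ∧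
    (H = ⨆ (p : Fin 4 × Fin 4) (h : p.1 < p.2), (P p h).toSubgraph) ∧
    (∀ p q hp hq, p ≠ q → ∀ x, x ∈ (P p hp).support → x ∈ (P q hq).support →
      x ∈ ({b p.1, b p.2} ∩ {b q.1, b q.2} : Set V))

/-- `H` is a subgraph of `G` that is a `K₄`-subdivision. -/
def IsK4Subdivision {G : SimpleGraph V} (H : G.Subgraph) : Prop :=
  ∃ b, IsK4SubdivisionOn H b

namespace SimpleGraph

/-- `b` can be reached from `a` by a walk of `G` that avoids `S`. -/
def AvoidReach (G : SimpleGraph V) (S : Set V) (a b : V) : Prop :=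
  ∃ p : G.Walk a b, ∀ x ∈ p.support, x ∉ S

/-- Every walk of `G` from `A` to `B` meets `S`. -/
def Separates (G : SimpleGraph V) (A B S : Set V) : Prop :=
  ∀ a ∈ A, ∀ b ∈ B, ¬ G.AvoidReach S a b

/-- `G` contains `k` pairwise disjoint paths from `A` to `B`. -/
def Linked (G : SimpleGraph V) (A B : Set V) (k : ℕ) : Prop :=
  ∃ (f g : Fin k → V) (P : ∀ i, G.Walk (f i) (g i)),
    (∀ i, f i ∈ A) ∧ (∀ i, g i ∈ B) ∧ (∀ i, (P i).IsPath) ∧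
    ∀ i j x, x ∈ (P i).support → x ∈ (P j).support → i = j

variable {G G' : SimpleGraph V} {A B S T : Set V} {a b c x y : V} {k : ℕ}

lemma AvoidReach.refl (h : a ∉ S) : G.AvoidReach S a a := ⟨.nil, by simpa using h⟩

lemma AvoidReach.symm (h : G.AvoidReach S a b) : G.AvoidReach S b a := by
  obtain ⟨p, hp⟩ := h
  exact ⟨p.reverse, by simpa using hp⟩

lemma AvoidReach.trans (h : G.AvoidReach S a b) (h' : G.AvoidReach S b c) :
    G.AvoidReach S a c := by
  obtain ⟨p, hp⟩ := h
  obtain ⟨q, hq⟩ := h'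
  refine ⟨p.append q, fun x hx => ?_⟩
  rcases (Walk.mem_support_append_iff _ _).1 hx with hx | hx
  exacts [hp x hx, hq x hx]

lemma AvoidReach.right_notMem (h : G.AvoidReach S a b) : b ∉ S := by
  obtain ⟨p, hp⟩ := h
  exact hp _ p.end_mem_support

lemma AvoidReach.step (h : G.AvoidReach S a b) (hbc : G.Adj b c) (hc : c ∉ S) :
    G.AvoidReach S a c :=
  h.trans ⟨hbc.toWalk, by simp [hc, h.right_notMem]⟩

lemma AvoidReach.mono (hST : S ⊆ T) (h : G.AvoidReach T a b) : G.AvoidReach S a b := by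
  obtain ⟨p, hp⟩ := h
  exact ⟨p, fun x hx hxS => hp x hx (hST hxS)⟩

lemma Separates.symm (h : G.Separates A B S) : G.Separates B A S :=
  fun b hb a ha hab => h a ha b hb hab.symm

lemma Linked.mono (h : G'.Linked A B k) (hle : G' ≤ G) : G.Linked A B k := by
  obtain ⟨f, g, P, hf, hg, hP, hd⟩ := h
  exact ⟨f, g, fun i => (P i).mapLe hle, hf, hg, fun i => (hP i).mapLe hle, by simpa using hd⟩

/-- If `S` separates `A` from `B` after deleting the edge `xy`, whose end `y` is on the side
of `B`, then whatever separates `A` from `S ∪ {x}` in the smaller graph separates `A` from `B`. -/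
lemma Separates.of_insert (hG : ∀ u v, G.Adj u v → G'.Adj u v ∨ (u = x ∧ v = y) ∨ (u = y ∧ v = x))
    (hS : G'.Separates A B S) (hb : b ∈ B) (hy : G'.AvoidReach S y b)
    (hT : G'.Separates A (insert x S) T) : G.Separates A B T := by
  rintro a ha c hc ⟨p, hp⟩
  let R : Set V := {z | ∃ a ∈ A, G'.AvoidReach (T ∪ insert x S) a z}
  have haT : a ∉ T := hp _ p.start_mem_support
  have haR : a ∈ R := ⟨a, ha, .refl fun h => h.elim haT fun h => hT a ha a h (.refl haT)⟩
  have hcR : c ∉ R := by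
    rintro ⟨a', ha', h⟩
    exact hS a' ha' c hc (h.mono fun z hz => .inr (.inr hz))
  obtain ⟨⟨⟨s, t⟩, hst⟩, hd, ⟨a', ha', hs⟩, ht⟩ := p.exists_boundary_dart R haR hcR
  have htT : t ∉ T := hp _ (p.dart_snd_mem_support_of_mem_darts hd)
  rcases hG s t hst with h | ⟨rfl, rfl⟩ | ⟨rfl, rfl⟩
  · refine ht ⟨a', ha', hs.step h fun h' => h'.elim htT fun h' => ?_⟩
    exact hT a' ha' t h' ((hs.mono Set.subset_union_left).step h htT)
  · exact hs.right_notMem (.inr (.inl rfl))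
  · exact hS a' ha' b hb ((hs.mono fun z hz => .inr (.inr hz)).trans hy)

lemma Walk.IsPath.avoidReach {p : G.Walk a b} (hp : p.IsPath)
    (hpS : ∀ w ∈ p.support, w ∈ S → w = b) (hx : x ∈ p.support) (hxS : x ∉ S) :
    G.AvoidReach S a x := by
  classical
  refine ⟨p.takeUntil x hx, fun w hw hwS => ?_⟩
  obtain rfl := hpS w (p.support_takeUntil_subset_support hx hw) hwS
  exact Walk.endpoint_notMem_support_takeUntil hp hx (by rintro rfl; exact hxS hwS) hw

lemma exists_eq_of_injective_of_card {X : Finset V} (hX : X.card = k) {g : Fin k → V}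
    (hg : g.Injective) (hgX : ∀ i, g i ∈ X) {z : V} (hz : z ∈ X) : ∃ i, g i = z := by
  classical
  have : Finset.univ.image g = X := Finset.eq_of_subset_of_card_le
    (by simpa [Finset.subset_iff] using hgX)
    (by rw [Finset.card_image_of_injective _ hg]; simp [hX])
  simpa [← this] using hz

/-- Linkages from `A` to `S ∪ {x}` and from `S ∪ {y}` to `B` can be joined along the edge `xy`
when `S` separates `A` from `B`. -/
lemma Linked.join [DecidableEq V] {S : Finset V} (hle : G' ≤ G) (hxy : G.Adj x y)
    (hS : G'.Separates A B S) (hxk : (insert x S).card = k) (hyk : (insert y S).card = k)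
    (hyS : y ∉ S)
    (h₁ : G'.Linked A (insert x S : Finset V) k) (h₂ : G'.Linked (insert y S : Finset V) B k) :
    G.Linked A B k := by
  obtain ⟨f, g, P, hf, hg, hP, hPd⟩ := h₁
  obtain ⟨f', g', Q, hf', hg', hQ, hQd⟩ := h₂
  have hgi : g.Injective := fun i j h => hPd i j (g i) (by simp) (by simp [h])
  have hfi : f'.Injective := fun i j h => hQd i j (f' i) (by simp) (by simp [h])
  have hgs {z : V} (hz : z ∈ insert x S) := exists_eq_of_injective_of_card hxk hgi hg hz
  have hfs {z : V} (hz : z ∈ insert y S) := exists_eq_of_injective_of_card hyk hfi hf' hz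
  have hPS : ∀ i, ∀ w ∈ (P i).support, w ∈ (S : Set V) → w = g i := fun i w hw hwS => by
    obtain ⟨j, rfl⟩ := hgs (Finset.mem_insert_of_mem hwS)
    rw [hPd i j _ hw (by simp)]
  have hQS : ∀ i, ∀ w ∈ (Q i).support, w ∈ (S : Set V) → w = f' i := fun i w hw hwS => by
    obtain ⟨j, rfl⟩ := hfs (Finset.mem_insert_of_mem hwS)
    rw [hQd i j _ hw (by simp)]
  have hPQ : ∀ i j z, z ∈ (P i).support → z ∈ (Q j).support → z ∈ S := fun i j z hz hz' => by
    by_contra hzS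
    refine hS _ (hf i) _ (hg' j) (((hP i).avoidReach (hPS i) hz hzS).trans ?_)
    exact ((hQ j).reverse.avoidReach (by simpa using hQS j) (by simpa using hz') hzS).symm
  have hσ : ∀ i, ∃ j, f' j = if g i = x then y else g i := fun i => hfs <| by
    have : g i = x ∨ g i ∈ S := by simpa using hg i
    grind
  choose σ hσ using hσ
  have hσi : σ.Injective := fun i j h => by
    have hi : g i = x ∨ g i ∈ S := by simpa using hg i
    have hj : g j = x ∨ g j ∈ S := by simpa using hg j
    have := hσ i
    rw [h, hσ j] at this
    apply hgi
    grind
  have hW : ∀ i, ∃ p : G.Walk (f i) (g' (σ i)), p.IsPath ∧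
      ∀ z ∈ p.support, z ∈ (P i).support ∨ z ∈ (Q (σ i)).support := fun i => by
    have hB : ∃ p : G.Walk (g i) (f' (σ i)), ∀ z ∈ p.support, z = g i ∨ z = f' (σ i) := by
      by_cases h : g i = x
      · rw [hσ, if_pos h, h]
        exact ⟨hxy.toWalk, by simp⟩
      · rw [hσ, if_neg h]
        exact ⟨.nil, by simp⟩
    obtain ⟨p, hp⟩ := hB
    refine ⟨(((P i).mapLe hle).append (p.append ((Q (σ i)).mapLe hle))).bypass,
      Walk.bypass_isPath _, fun z hz => ?_⟩
    have := Walk.support_bypass_subset_support _ hz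
    simp only [Walk.mem_support_append_iff, Walk.support_mapLe_eq_support] at this
    rcases this with h | h | h
    · exact .inl h
    · rcases hp z h with rfl | rfl <;> simp
    · exact .inr h
  choose W hWp hW using hW
  have key : ∀ i j z, z ∈ (P i).support → z ∈ (Q (σ j)).support → i = j := fun i j z hz hz' => by
    have hzS := hPQ i _ z hz hz'
    have h₁ := hPS i z hz hzS
    have h₂ := hQS _ z hz' hzS
    rw [hσ] at h₂
    apply hgi
    split_ifs at h₂ with h
    · exact absurd (h₂ ▸ hzS) hyS
    · rw [← h₁, h₂]
  refine ⟨f, fun i => g' (σ i), W, hf, fun i => hg' _, hWp, fun i j z hi hj => ?_⟩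
  rcases hW i z hi with hi | hi <;> rcases hW j z hj with hj | hj
  · exact hPd i j z hi hj
  · exact key i j z hi hj
  · exact (key j i z hj hi).symm
  · exact hσi (hQd _ _ z hi hj)

/-- Menger's theorem for two sets of vertices. -/
theorem linked_of_forall_separates [Finite V] (G : SimpleGraph V) (A B : Set V) (k : ℕ)
    (h : ∀ S : Finset V, G.Separates A B S → k ≤ S.card) : G.Linked A B k := by
  classical
  have := Fintype.ofFinite V
  induction G using WellFoundedLT.induction generalizing A B with
  | ind G ih =>
  by_cases hbot : G = ⊥
  · subst hbot
    have hk := h (A ∩ B).toFinset (by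
      rintro a ha b hb ⟨p, hp⟩
      cases p with
      | nil => exact hp a (by simp) (by simp [ha, hb])
      | cons hadj _ => exact hadj)
    obtain ⟨X, hX, hXk⟩ := Finset.exists_subset_card_eq hk
    let e := X.equivFinOfCardEq hXk
    have he : ∀ i, (e.symm i : V) ∈ A ∩ B := fun i => by simpa using hX (e.symm i).2
    refine ⟨fun i => e.symm i, fun i => e.symm i, fun i => .nil, fun i => (he i).1,
      fun i => (he i).2, fun i => .nil, fun i j x hi hj => ?_⟩
    simp only [Walk.support_nil, List.mem_singleton] at hi hj
    exact e.symm.injective (Subtype.ext (hi.symm.trans hj))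
  obtain ⟨u, v, huv⟩ := ne_bot_iff_exists_adj.1 hbot
  set G' := G.deleteEdges {s(u, v)} with hG'
  have hle : G' ≤ G := deleteEdges_le _
  have hlt : G' < G := lt_of_le_of_ne hle fun h' => by
    have : G'.Adj u v := h' ▸ huv
    simp [hG'] at this
  by_cases hsep : ∀ S : Finset V, G'.Separates A B S → k ≤ S.card
  · exact (ih G' hlt A B hsep).mono hle
  push Not at hsep
  obtain ⟨S, hS, hSk⟩ := hsep
  have hGS : ¬ G.Separates A B S := fun h' => hSk.not_ge (h S h')
  simp only [Separates, not_forall, not_not] at hGS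
  obtain ⟨a, ha, b, hb, p, hp⟩ := hGS
  have hadj : ∀ s t, G.Adj s t → G'.Adj s t ∨ s(s, t) = s(u, v) := fun s t hst => by
    by_cases h' : s(s, t) = s(u, v)
    · exact .inr h'
    · exact .inl (by simpa [hG', hst] using h')
  let RA : Set V := {z | ∃ a ∈ A, G'.AvoidReach S a z}
  let RB : Set V := {z | ∃ b ∈ B, G'.AvoidReach S z b}
  have hRAB : ∀ z ∈ RA, z ∉ RB := by
    rintro z ⟨a, ha, haz⟩ ⟨b, hb, hzb⟩
    exact hS a ha b hb (haz.trans hzb)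
  have haR : a ∈ RA := ⟨a, ha, .refl (hp _ p.start_mem_support)⟩
  have hbR : b ∈ RB := ⟨b, hb, .refl (hp _ p.end_mem_support)⟩
  obtain ⟨⟨⟨x, y⟩, hxy⟩, hd, hx, hy⟩ := p.exists_boundary_dart RA haR fun h => hRAB b h hbR
  obtain ⟨⟨⟨s, t⟩, hst⟩, hd', hs, ht⟩ := p.exists_boundary_dart RBᶜ (hRAB a haR) fun h => h hbR
  simp only [Set.mem_compl_iff, not_not] at hx hy hs ht
  have hxyE : s(x, y) = s(u, v) := (hadj x y hxy).resolve_left fun h' => by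
    obtain ⟨a, ha, hax⟩ := hx
    exact hy ⟨a, ha, hax.step h' (hp _ (p.dart_snd_mem_support_of_mem_darts hd))⟩
  have hstE : s(s, t) = s(u, v) := (hadj s t hst).resolve_left fun h' => by
    obtain ⟨b, hb, htb⟩ := ht
    exact hs ⟨b, hb, (htb.symm.step h'.symm
      (hp _ (p.dart_fst_mem_support_of_mem_darts hd'))).symm⟩
  have hyB : y ∈ RB := by
    rcases Sym2.eq_iff.1 (hstE.trans hxyE.symm) with ⟨rfl, rfl⟩ | ⟨rfl, rfl⟩
    · exact ht
    · exact absurd ht (hRAB _ hx)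
  have hadj' : ∀ s t, G.Adj s t → G'.Adj s t ∨ (s = x ∧ t = y) ∨ (s = y ∧ t = x) :=
    fun s t hst => (hadj s t hst).imp_right fun h' => Sym2.eq_iff.1 (h'.trans hxyE.symm)
  obtain ⟨a', ha', hax⟩ := hx
  obtain ⟨b', hb', hyb⟩ := hyB
  have hX : ∀ T : Finset V, G'.Separates A (insert x S : Finset V) T → k ≤ T.card :=
    fun T hT => h T (Separates.of_insert hadj' hS hb' hyb (by simpa using hT))
  have hY : ∀ T : Finset V, G'.Separates (insert y S : Finset V) B T → k ≤ T.card :=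
    fun T hT => h T (Separates.of_insert (x := y) (y := x)
      (fun s t hst => (hadj' s t hst).imp_right Or.symm) hS.symm ha' hax.symm
      (by simpa using hT.symm)).symm
  have hXk := hX (insert x S) fun a _ b hb h => h.right_notMem hb
  have hYk := hY (insert y S) fun a ha b _ h => h.symm.right_notMem ha
  have hx1 := Finset.card_insert_le x S
  have hy1 := Finset.card_insert_le y S
  exact Linked.join hle hxy hS (by lia) (by lia) hyb.symm.right_notMem
    (ih G' hlt _ _ hX) (ih G' hlt _ _ hY)

lemma Walk.exists_walk_first_mem (p : G.Walk a b) (hb : b ∈ B) :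
    ∃ c ∈ B, ∃ q : G.Walk a c, q.support ⊆ p.support ∧ ∀ x ∈ q.support, x ∈ B → x = c := by
  induction p with
  | nil => exact ⟨_, hb, .nil, by simp, by simp⟩
  | @cons u v w h p ih =>
    by_cases hu : u ∈ B
    · exact ⟨u, hu, .nil, by simp, by simp⟩
    · obtain ⟨c, hc, q, hqp, hq⟩ := ih hb
      refine ⟨c, hc, .cons h q, ?_, ?_⟩
      · simp only [support_cons]
        exact List.cons_subset_cons _ hqp
      · simpa [hu] using hq

/-- The fan lemma: a vertex of a `k`-connected graph sends `k` paths to any set of at least `k`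
other vertices that are disjoint apart from their common start and meet the set only at
their ends. -/
theorem exists_fan [Fintype V] {G : SimpleGraph V} {k : ℕ} (hG : IsKConnected k G) {v : V}
    {B : Set V} (hv : v ∉ B) (hB : ∀ S : Finset V, S.card < k → ∃ b ∈ B, b ∉ S) :
    ∃ (g : Fin k → V) (P : ∀ i, G.Walk v (g i)), g.Injective ∧ (∀ i, g i ∈ B) ∧
      (∀ i, (P i).IsPath) ∧ (∀ i, ∀ x ∈ (P i).support, x ∈ B → x = g i) ∧
      ∀ i j x, i ≠ j → x ∈ (P i).support → x ∈ (P j).support → x = v := by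
  classical
  let G' := G.deleteIncidenceSet v
  have hle : G' ≤ G := G.deleteIncidenceSet_le v
  have hlink : G'.Linked (G.neighborSet v) B k := by
    refine linked_of_forall_separates _ _ _ _ fun S hS => ?_
    by_contra! hSk
    obtain ⟨b, hb, hbS⟩ := hB S hSk
    have hbv : b ≠ v := by rintro rfl; exact hv hb
    let T := S.erase v
    have hTc := hG.2 T ((Finset.card_erase_le).trans_lt hSk)
    obtain ⟨p⟩ := hTc.preconnected ⟨v, by simp [T]⟩ ⟨b, by simp [T, hbS]⟩
    let p' : G.Walk v b := (p.map (Embedding.induce _).toHom)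
    have hp' : ∀ x ∈ p'.support, x ∉ T := fun x hx => by
      have hx' : x ∈ (p.map (Embedding.induce _).toHom).support := hx
      rw [Walk.support_map, List.mem_map] at hx'
      obtain ⟨⟨z, hz⟩, -, rfl⟩ := hx'
      exact hz
    have hq' : ∀ x ∈ p'.bypass.support, x ∉ T := fun x hx => hp' x (p'.support_bypass_subset_support hx)
    have hq := p'.bypass_isPath
    generalize p'.bypass = q at hq hq'
    cases q with
    | nil => exact hbv rfl
    | cons hadj q =>
      rw [Walk.cons_isPath_iff] at hq
      have hqe : ∀ e ∈ q.edges, e ∈ G'.edgeSet := fun e he => by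
        induction e with
        | h s t =>
        have hs := q.fst_mem_support_of_mem_edges he
        have ht := q.snd_mem_support_of_mem_edges he
        have := q.adj_of_mem_edges he
        refine (deleteIncidenceSet_adj).2 ⟨this, ?_, ?_⟩ <;> rintro rfl <;> exact hq.2 ‹_›
      refine hS _ hadj b hb ⟨q.transfer G' hqe, fun x hx hxS => ?_⟩
      rw [Walk.support_transfer] at hx
      refine hq' x (by simp [hx]) (Finset.mem_erase.2 ⟨?_, hxS⟩)
      rintro rfl
      exact hq.2 hx
  obtain ⟨f, g, P, hf, hg, -, hd⟩ := hlink
  have hvP : ∀ i, v ∉ (P i).support := fun i hi => by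
    have hne : f i ≠ v := (G.ne_of_adj (hf i)).symm
    obtain ⟨⟨⟨s, t⟩, hst⟩, -, hs, ht⟩ :=
      ((P i).takeUntil v hi).exists_boundary_dart {v}ᶜ hne (by simp)
    exact (deleteIncidenceSet_adj.1 hst).2.2 (by simpa using ht)
  choose g' hg' Q hQP hQ using fun i => (P i).exists_walk_first_mem (hg i)
  let W : ∀ i, G.Walk v (g' i) := fun i => .cons (hf i) ((Q i).mapLe hle).bypass
  have hW : ∀ i x, x ∈ (W i).support → x = v ∨ x ∈ (Q i).support := fun i x hx => by
    refine (List.mem_cons.1 (show x ∈ v :: ((Q i).mapLe hle).bypass.support from hx)).imp_right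
      fun h => ?_
    simpa using Walk.support_bypass_subset_support _ h
  refine ⟨g', W, fun i j h => ?_, hg', fun i => ?_, fun i x hx hxB => ?_,
    fun i j x hij hi hj => ?_⟩
  · exact hd i j (g' i) (hQP i (by simp)) (hQP j (by simp [h]))
  · refine (Walk.cons_isPath_iff _ _).2 ⟨Walk.bypass_isPath _, fun h => hvP i (hQP i ?_)⟩
    simpa using Walk.support_bypass_subset_support _ h
  · rcases hW i x hx with rfl | hx
    · exact absurd hxB hv
    · exact hQ i x hx hxB
  · by_contra hxv
    exact hij (hd i j x (hQP i ((hW i x hi).resolve_left hxv))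
      (hQP j ((hW j x hj).resolve_left hxv)))

/-- `c` is the union of three internally disjoint paths joining `x`, `y` and `z` pairwise. -/
def Walk.SplitsAt (c : G.Walk a a) (x y z : V) : Prop :=
  ∃ (p : G.Walk x y) (q : G.Walk y z) (r : G.Walk z x),
    p.IsPath ∧ q.IsPath ∧ r.IsPath ∧
    c.toSubgraph = p.toSubgraph ⊔ q.toSubgraph ⊔ r.toSubgraph ∧
    (∀ w ∈ p.support, w ∈ q.support → w = y) ∧ (∀ w ∈ q.support, w ∈ r.support → w = z) ∧
    (∀ w ∈ p.support, w ∈ r.support → w = x)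

lemma Walk.SplitsAt.swap {c : G.Walk a a} {z : V} (h : c.SplitsAt x y z) : c.SplitsAt x z y := by
  obtain ⟨p, q, r, hp, hq, hr, hc, hpq, hqr, hpr⟩ := h
  refine ⟨r.reverse, q.reverse, p.reverse, hr.reverse, hq.reverse, hp.reverse, ?_, ?_, ?_, ?_⟩
  · simp only [toSubgraph_reverse, hc]
    ac_rfl
  all_goals
    simp only [support_reverse, List.mem_reverse]
    grind

lemma Walk.IsCycle.splitsAt_of_append {p : G.Walk x y} {z : V} {q : G.Walk y z} {r : G.Walk z x}
    (hc : (p.append (q.append r)).IsCycle) (hxy : x ≠ y) (hyz : y ≠ z) (hxz : x ≠ z) :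
    (p.append (q.append r)).SplitsAt x y z := by
  have hn := hc.support_nodup
  rw [tail_support_append, tail_support_append] at hn
  have hmem {s t : V} (w : G.Walk s t) (hst : s ≠ t) : t ∈ w.support.tail := by
    have := w.end_mem_support
    rw [← cons_tail_support] at this
    exact (List.mem_cons.1 this).resolve_left hst.symm
  have hy := hmem p hxy
  have hz := hmem q hyz
  have hx := hmem r hxz.symm
  simp only [List.nodup_append, List.mem_append] at hn
  refine ⟨p, q, r, ?_, ?_, ?_, ?_, ?_, ?_, ?_⟩
  · rw [isPath_def, ← cons_tail_support, List.nodup_cons]; grind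
  · rw [isPath_def, ← cons_tail_support, List.nodup_cons]; grind
  · rw [isPath_def, ← cons_tail_support, List.nodup_cons]; grind
  · simp only [toSubgraph_append, sup_assoc]
  all_goals
    intro w h₁ h₂
    rw [← cons_tail_support, List.mem_cons] at h₁ h₂
    grind

lemma Walk.IsCycle.splitsAt {c : G.Walk a a} (hc : c.IsCycle) {z : V} (hx : x ∈ c.support)
    (hy : y ∈ c.support) (hz : z ∈ c.support) (hxy : x ≠ y) (hyz : y ≠ z) (hxz : x ≠ z) :
    c.SplitsAt x y z := by
  classical
  have hsub : (c.rotate x hx).toSubgraph = c.toSubgraph := c.toSubgraph_rotate hx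
  have hy' : y ∈ (c.rotate x hx).support := by
    rw [← mem_verts_toSubgraph, hsub]; simpa using hy
  have hz' : z ∈ (c.rotate x hx).support := by
    rw [← mem_verts_toSubgraph, hsub]; simpa using hz
  suffices (c.rotate x hx).SplitsAt x y z by
    simpa only [SplitsAt, hsub] using this
  have hc' := hc.rotate hx
  generalize c.rotate x hx = d at hc' hy' hz'
  rw [← d.take_spec hy'] at hz' hc' ⊢
  generalize d.takeUntil y hy' = p at *
  generalize d.dropUntil y hy' = q at *
  rcases (mem_support_append_iff _ _).1 hz' with h | h
  · rw [← p.take_spec h, ← append_assoc] at hc' ⊢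
    exact (hc'.splitsAt_of_append hxz hyz.symm hxy).swap
  · rw [← q.take_spec h] at hc' ⊢
    exact hc'.splitsAt_of_append hxy hyz hxz

/-- Three paths from `v` to `g 0`, `g 1`, `g 2` and three paths joining these three vertices
pairwise form a `K₄`-subdivision if they meet only in common ends. -/
lemma exists_isK4SubdivisionOn {v : V} {g : Fin 3 → V} (hg : g.Injective) (hv : ∀ i, v ≠ g i)
    {P : ∀ i, G.Walk v (g i)} {p : G.Walk (g 0) (g 1)} {q : G.Walk (g 1) (g 2)}
    {r : G.Walk (g 2) (g 0)} (hP : ∀ i, (P i).IsPath) (hp : p.IsPath) (hq : q.IsPath)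
    (hr : r.IsPath) (hPP : ∀ i j x, i ≠ j → x ∈ (P i).support → x ∈ (P j).support → x = v)
    (hpP : ∀ i, ∀ x ∈ (P i).support, x ∈ p.support → x = g i)
    (hqP : ∀ i, ∀ x ∈ (P i).support, x ∈ q.support → x = g i)
    (hrP : ∀ i, ∀ x ∈ (P i).support, x ∈ r.support → x = g i)
    (hpq : ∀ x ∈ p.support, x ∈ q.support → x = g 1)
    (hqr : ∀ x ∈ q.support, x ∈ r.support → x = g 2)
    (hpr : ∀ x ∈ p.support, x ∈ r.support → x = g 0) :
    ∃ H : G.Subgraph, IsK4SubdivisionOn H (Fin.cons v g : Fin 4 → V) ∧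
      p.toSubgraph ⊔ q.toSubgraph ⊔ r.toSubgraph ≤ H := by
  have hp2 : g 2 ∉ p.support := fun h => hg.ne (by decide) (hpq _ h (by simp))
  have hq0 : g 0 ∉ q.support := fun h => hg.ne (by decide) (hqr _ h (by simp))
  have hr1 : g 1 ∉ r.support := fun h => hg.ne (by decide) (hpr _ (by simp) h)
  let b : Fin 4 → V := Fin.cons v g
  have hb : b.Injective := Fin.cons_injective_iff.2 ⟨fun ⟨i, hi⟩ => hv i hi.symm, hg⟩
  let W : ∀ e : Fin 4 × Fin 4, e.1 < e.2 → G.Walk (b e.1) (b e.2) := fun e he =>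
    match e, he with
    | (0, 1), _ => P 0
    | (0, 2), _ => P 1
    | (0, 3), _ => P 2
    | (1, 2), _ => p
    | (1, 3), _ => r.reverse
    | (2, 3), _ => q
    | (3, j), h => ((Fin.le_last j).not_gt h).elim
  have hW : ∀ e h, (W e h).IsPath := by
    rintro ⟨i, j⟩ h
    fin_cases i <;> fin_cases j <;> first | exact absurd h (by decide) | skip
    exacts [hP 0, hP 1, hP 2, hp, hr.reverse, hq]
  have mem_r {x : V} (h : x ∈ r.reverse.support) : x ∈ r.support := by simpa using h
  have hlt : ∀ e f he hf, e.1.1 < f.1.1 ∨ e.1.1 = f.1.1 ∧ e.2.1 < f.2.1 →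
      ∀ x ∈ (W e he).support, x ∈ (W f hf).support →
        (x = b e.1 ∨ x = b e.2) ∧ (x = b f.1 ∨ x = b f.2) := by
    rintro ⟨i, j⟩ ⟨k, l⟩ he hf h
    fin_cases i <;> fin_cases j <;> first | exact absurd he (by decide) | skip
    all_goals
      fin_cases k <;> fin_cases l <;>
        first | exact absurd hf (by decide) | exact absurd h (by decide) | skip
    all_goals intro x hx hy
    · exact (fun h => ⟨.inl h, .inl h⟩) (hPP 0 1 x (by decide) hx hy)
    · exact (fun h => ⟨.inl h, .inl h⟩) (hPP 0 2 x (by decide) hx hy)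
    · exact (fun h => ⟨.inr h, .inl h⟩) (hpP 0 x hx hy)
    · exact (fun h => ⟨.inr h, .inl h⟩) (hrP 0 x hx (mem_r hy))
    · exact absurd (hqP 0 x hx hy ▸ hy) hq0
    · exact (fun h => ⟨.inl h, .inl h⟩) (hPP 1 2 x (by decide) hx hy)
    · exact (fun h => ⟨.inr h, .inr h⟩) (hpP 1 x hx hy)
    · exact absurd (hrP 1 x hx (mem_r hy) ▸ mem_r hy) hr1
    · exact (fun h => ⟨.inr h, .inl h⟩) (hqP 1 x hx hy)
    · exact absurd (hpP 2 x hx hy ▸ hy) hp2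
    · exact (fun h => ⟨.inr h, .inr h⟩) (hrP 2 x hx (mem_r hy))
    · exact (fun h => ⟨.inr h, .inr h⟩) (hqP 2 x hx hy)
    · exact (fun h => ⟨.inl h, .inl h⟩) (hpr x hx (mem_r hy))
    · exact (fun h => ⟨.inr h, .inl h⟩) (hpq x hx hy)
    · exact (fun h => ⟨.inr h, .inr h⟩) (hqr x hy (mem_r hx))
  refine ⟨_, ⟨hb, W, hW, fun e h => ?_, rfl, fun e f he hf hef x hx hx' => ?_⟩, ?_⟩
  · exact Nat.pos_of_ne_zero fun h0 => h.ne (hb (Walk.eq_of_length_eq_zero h0))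
  · by_cases h : e.1.1 < f.1.1 ∨ e.1.1 = f.1.1 ∧ e.2.1 < f.2.1
    · exact hlt e f he hf h x hx hx'
    · have h' : f.1.1 < e.1.1 ∨ f.1.1 = e.1.1 ∧ f.2.1 < e.2.1 := by
        by_contra hn
        exact hef (Prod.ext (Fin.ext (by lia)) (Fin.ext (by lia)))
      exact (hlt f e hf he h' x hx' hx).symm
  · have hle (e : Fin 4 × Fin 4) (h : e.1 < e.2) :
        (W e h).toSubgraph ≤ ⨆ (e : Fin 4 × Fin 4) (h : e.1 < e.2), (W e h).toSubgraph :=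
      le_iSup₂ (f := fun e h => (W e h).toSubgraph) e h
    refine sup_le (sup_le (hle (1, 2) (by decide)) (hle (2, 3) (by decide))) ?_
    exact r.toSubgraph_reverse.ge.trans (hle (1, 3) (by decide))

end SimpleGraph

/-- Let `G` be a 3-connected graph, `v` a vertex of `G` and `C` a cycle of
`G - v` (i.e. a cycle subgraph of `G` avoiding `v`). Then `G` contains a `K₄`-subdivision
that contains `C` as a subgraph and has `v` as one of its real vertices. -/
theorem stmt6 [Fintype V] {G : SimpleGraph V} (hG : IsKConnected 3 G) (v : V)
    (C : G.Subgraph) (hC : IsCycleSubgraph C) (hv : v ∉ C.verts) :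
    ∃ (H : G.Subgraph) (b : Fin 4 → V),
      IsK4SubdivisionOn H b ∧ C ≤ H ∧ v ∈ Set.range b := by
  classical
  obtain ⟨u, c, hc, rfl⟩ := hC
  obtain ⟨g, P, hg, hgB, hP, hPB, hPd⟩ := exists_fan hG hv fun S hS => by
    by_contra! h
    have hsub : c.support.tail.toFinset ⊆ S := fun x hx =>
      h x (by simpa using List.mem_of_mem_tail (List.mem_toFinset.1 hx))
    have h₁ := Finset.card_le_card hsub
    rw [List.toFinset_card_of_nodup hc.support_nodup] at h₁
    have h₂ := hc.three_le_length
    simp at h₁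
    lia
  simp only [Walk.mem_verts_toSubgraph] at hgB hPB hv
  obtain ⟨p, q, r, hp, hq, hr, hsub, hpq, hqr, hpr⟩ := hc.splitsAt (hgB 0) (hgB 1) (hgB 2)
    (hg.ne (by decide)) (hg.ne (by decide)) (hg.ne (by decide))
  have hmem (w : V) : w ∈ c.support ↔ (w ∈ p.support ∨ w ∈ q.support) ∨ w ∈ r.support := by
    simpa using Set.ext_iff.1 (congrArg Subgraph.verts hsub) w
  obtain ⟨H, hH, hle⟩ := exists_isK4SubdivisionOn (v := v) hg (fun i h => hv (h.symm ▸ hgB i))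
    hP hp hq hr hPd
    (fun i x hx h => hPB i x hx ((hmem x).2 (.inl (.inl h))))
    (fun i x hx h => hPB i x hx ((hmem x).2 (.inl (.inr h))))
    (fun i x hx h => hPB i x hx ((hmem x).2 (.inr h))) hpq hqr hpr
  exact ⟨H, _, hH, hsub.trans_le hle, 0, rfl⟩
end
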